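/- arXiv:2002.11266 — 3 statements merged into one kernel-verified Lean document; each statement's English description precedes it below -/
import Mathlib

section
/- Let n be an odd integer with n ≥ 7 and n ≡ 3 (mod 4), let q ≥ 2, and let C be an (n,m,q) wide-sense 2-frameproof code. Then m ≤ (n choose (n−1)/2) − ((n+1)² − 8)/8 − ⌊(n−3)²/64⌋. -/
/-- The wide-sense descendant set of a set `X` of words: all words agreeing with the
words of `X` on every position undetectable for `X` (i.e. where all words of `X` agree). -/
def wdesc {n : ℕ} {Q : Type*} (X : Finset (Fin n → Q)) : Set (Fin n → Q) :=
  {y | ∀ i : Fin n, (∀ x ∈ X, ∀ x' ∈ X, x i = x' i) → ∀ x ∈ X, y i = x i}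

/-- A code `C` is wide-sense 2-frameproof if `wdesc X ∩ C = X` for every nonempty
subset `X ⊆ C` with `|X| ≤ 2`. -/
def IsWFP2 {n : ℕ} {Q : Type*} (C : Finset (Fin n → Q)) : Prop :=
  ∀ X : Finset (Fin n → Q), X ⊆ C → X.Nonempty → X.card ≤ 2 →
    wdesc X ∩ (C : Set (Fin n → Q)) = (X : Set (Fin n → Q))

open Finset

/-- Binomial coefficients are increasing up to the middle. -/
theorem Nat.choose_le_choose_of_le_half {n i j : ℕ} (hij : i ≤ j) (hj : j ≤ n / 2) :
    n.choose i ≤ n.choose j := by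
  induction j, hij using Nat.le_induction with
  | base => exact le_rfl
  | succ k _ ih =>
    exact (ih (by omega)).trans (Nat.choose_le_succ_of_lt_half_left (by omega))

/-- In `Finset β` with `|β| = 2 * r`, every layer but the middle one has at most
`(2 * r).choose (r - 1)` members. -/
theorem Nat.choose_two_mul_le_of_ne {r s : ℕ} (hs : s ≠ r) :
    (2 * r).choose s ≤ (2 * r).choose (r - 1) := by
  rcases lt_or_gt_of_ne hs with h | h
  · exact Nat.choose_le_choose_of_le_half (by omega) (by omega)
  · rcases le_or_gt s (2 * r) with h' | h'
    · rw [← Nat.choose_symm h']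
      exact Nat.choose_le_choose_of_le_half (by omega) (by omega)
    · simp [Nat.choose_eq_zero_of_lt h']

theorem Nat.choose_two_mul_add_one {r : ℕ} (hr : 1 ≤ r) :
    (2 * r + 1).choose r = (2 * r).choose (r - 1) + (2 * r).choose r := by
  obtain ⟨s, rfl⟩ := Nat.exists_eq_add_of_le' hr
  exact Nat.choose_succ_succ _ _

/-- An antichain of subsets of a `2 * r`-set without complementary pairs has at most half of
`(2 * r + 1).choose r` members. -/
theorem IsAntichain.two_mul_card_le_of_compl_notMem {β : Type*} [Fintype β] [DecidableEq β]
    {r : ℕ} (hr : 1 ≤ r) (hβ : Fintype.card β = 2 * r) {F : Finset (Finset β)}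
    (hF : IsAntichain (· ⊆ ·) (F : Set (Finset β))) (hc : ∀ A ∈ F, Aᶜ ∉ F) :
    2 * #F ≤ (2 * r + 1).choose r := by
  set a := (2 * r).choose (r - 1)
  set b := (2 * r).choose r
  have ha : 0 < a := Nat.choose_pos (by omega)
  have hab : a ≤ b := Nat.choose_le_choose_of_le_half (by omega) (by omega)
  set t := F.filter (#· = r)
  set u := F.filter (¬ #· = r)
  have htu : #t + #u = #F := card_filter_add_card_filter_not _
  have ht : 2 * #t ≤ b := by
    have hd : Disjoint t (t.image compl) := by
      rw [disjoint_left]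
      intro A hA hA'
      obtain ⟨B, hB, rfl⟩ := mem_image.1 hA'
      exact hc B (mem_filter.1 hB).1 (mem_filter.1 hA).1
    have hsub : t ∪ t.image compl ⊆ powersetCard r univ := by
      intro A hA
      rw [mem_powersetCard_univ]
      rcases mem_union.1 hA with h | h
      · exact (mem_filter.1 h).2
      · obtain ⟨B, hB, rfl⟩ := mem_image.1 h
        have := (mem_filter.1 hB).2
        rw [card_compl, hβ]
        omega
    have := card_le_card hsub
    rw [card_union_of_disjoint hd, card_image_of_injective _ compl_injective,
      card_powersetCard, card_univ, hβ] at this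
    omega
  have hlym := lubell_yamamoto_meshalkin_inequality_sum_inv_choose (𝕜 := ℚ) hF
  rw [hβ, ← sum_filter_add_sum_filter_not F (#· = r)] at hlym
  have h1 : (#t : ℚ) * (b : ℚ)⁻¹ = ∑ s ∈ t, (((2 * r).choose #s : ℕ) : ℚ)⁻¹ := by
    rw [← nsmul_eq_mul, ← sum_const]
    exact sum_congr rfl fun s hs => by rw [(mem_filter.1 hs).2]
  have h2 : (#u : ℚ) * (a : ℚ)⁻¹ ≤ ∑ s ∈ u, (((2 * r).choose #s : ℕ) : ℚ)⁻¹ := by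
    rw [← nsmul_eq_mul, ← sum_const]
    refine sum_le_sum fun s hs => ?_
    have hpos : 0 < (2 * r).choose #s := Nat.choose_pos (hβ ▸ card_le_univ s)
    have hle := Nat.choose_two_mul_le_of_ne (mem_filter.1 hs).2
    gcongr
  have h3 : (#t : ℚ) * (b : ℚ)⁻¹ + (#u : ℚ) * (a : ℚ)⁻¹ ≤ 1 := by linarith
  have ha' : (0 : ℚ) < a := by exact_mod_cast ha
  have hb' : (0 : ℚ) < b := by exact_mod_cast ha.trans_le hab
  have h4 : (#t : ℚ) * a + #u * b ≤ a * b := by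
    have := mul_le_mul_of_nonneg_right h3 (mul_pos ha' hb').le
    field_simp at this
    linarith
  have h5 : #t * a + #u * b ≤ a * b := by exact_mod_cast h4
  rw [Nat.choose_two_mul_add_one hr, ← htu]
  refine le_of_mul_le_mul_right (a := b) ?_ (ha.trans_le hab)
  change 2 * (#t + #u) * b ≤ (a + b) * b
  nlinarith [Nat.mul_le_mul_right (b - a) ht, Nat.sub_add_cancel hab]

/-- Sets that agree outside `W` form an antichain as soon as their traces on `W` do. -/
theorem exists_antichain_subtype {α ι : Type*} [DecidableEq α] {Z : Finset ι} {D : ι → Finset α}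
    {W K : Finset α} (hK : ∀ z ∈ Z, D z \ W = K)
    (hD : ∀ y ∈ Z, ∀ z ∈ Z, D y ⊆ D z → y = z) :
    Set.InjOn (fun z => (D z).subtype (· ∈ W)) Z ∧
      IsAntichain (· ⊆ ·)
        ((Z.image fun z => (D z).subtype (· ∈ W) : Finset (Finset W)) : Set (Finset W)) := by
  have key : ∀ y ∈ Z, ∀ z ∈ Z, (D y).subtype (· ∈ W) ⊆ (D z).subtype (· ∈ W) → y = z := by
    intro y hy z hz h
    refine hD y hy z hz fun i hi => ?_
    by_cases hiW : i ∈ W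
    · have : (⟨i, hiW⟩ : W) ∈ (D z).subtype (· ∈ W) := h (by simpa using hi)
      simpa using this
    · have : i ∈ D y \ W := mem_sdiff.2 ⟨hi, hiW⟩
      rw [hK y hy, ← hK z hz] at this
      exact (mem_sdiff.1 this).1
  refine ⟨fun y hy z hz h => key y hy z hz (by simpa using h.le), ?_⟩
  rintro _ hA _ hB hne h
  obtain ⟨y, hy, rfl⟩ := mem_image.1 (mem_coe.1 hA)
  obtain ⟨z, hz, rfl⟩ := mem_image.1 (mem_coe.1 hB)
  exact hne (by rw [key y hy z hz h])

/-- Sperner's theorem for sets that agree outside `W`. -/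
theorem card_le_choose_of_sdiff_eq {α ι : Type*} [DecidableEq α] {Z : Finset ι} {D : ι → Finset α}
    {W K : Finset α} (hK : ∀ z ∈ Z, D z \ W = K)
    (hD : ∀ y ∈ Z, ∀ z ∈ Z, D y ⊆ D z → y = z) :
    #Z ≤ (#W).choose (#W / 2) := by
  obtain ⟨hinj, hanti⟩ := exists_antichain_subtype hK hD
  rw [← card_image_of_injOn hinj]
  simpa using hanti.sperner

section Difference

variable {n : ℕ} {Q : Type*} [DecidableEq Q]

/-- The set of positions where two words differ. -/
def diffSet (x y : Fin n → Q) : Finset (Fin n) := univ.filter fun i => x i ≠ y i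

@[simp] theorem mem_diffSet {x y : Fin n → Q} {i : Fin n} : i ∈ diffSet x y ↔ x i ≠ y i := by
  simp [diffSet]

theorem diffSet_comm (x y : Fin n → Q) : diffSet x y = diffSet y x := by
  ext i; simp [ne_comm]

variable {C : Finset (Fin n → Q)} {x y z : Fin n → Q}

theorem IsWFP2.eq_of_diffSet_subset (h : IsWFP2 C) (hx : x ∈ C) (hy : y ∈ C) (hz : z ∈ C)
    (hzx : z ≠ x) (hs : diffSet x z ⊆ diffSet x y) : z = y := by
  have hX := h {x, y} (by simp [insert_subset_iff, hx, hy]) (by simp) card_le_two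
  have : z ∈ wdesc {x, y} ∩ (C : Set (Fin n → Q)) := by
    refine ⟨fun i hi => ?_, hz⟩
    have hxy : x i = y i := hi x (by simp) y (by simp)
    have hxz : x i = z i := by
      by_contra hne
      exact mem_diffSet.1 (hs (mem_diffSet.2 hne)) hxy
    simp [← hxy, ← hxz]
  rw [hX] at this
  simpa [hzx] using this

theorem IsWFP2.exists_mem_diffSet_inter (h : IsWFP2 C) (hx : x ∈ C) (hy : y ∈ C) (hz : z ∈ C)
    (hxy : x ≠ y) (hxz : x ≠ z) : ∃ i, x i ≠ y i ∧ x i ≠ z i := by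
  by_contra! hcon
  refine hxz (h.eq_of_diffSet_subset hy hz hx hxy fun i hi => ?_)
  rw [mem_diffSet] at hi ⊢
  rw [← hcon i hi.symm]
  exact hi

theorem IsWFP2.card_le_of_sdiff_eq (h : IsWFP2 C) (hx : x ∈ C) {Z : Finset (Fin n → Q)}
    (hZ : Z ⊆ C.erase x) {W K : Finset (Fin n)} (hK : ∀ z ∈ Z, diffSet x z \ W = K) :
    #Z ≤ (#W).choose (#W / 2) :=
  card_le_choose_of_sdiff_eq hK fun _ hy _ hz =>
    h.eq_of_diffSet_subset hx (mem_of_mem_erase (hZ hz)) (mem_of_mem_erase (hZ hy))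
      (ne_of_mem_erase (hZ hy))

theorem filter_ne_subset_erase (C : Finset (Fin n → Q)) (x : Fin n → Q) (i : Fin n) :
    C.filter (fun z => x i ≠ z i) ⊆ C.erase x := by
  intro z hz
  obtain ⟨hzC, hzi⟩ := mem_filter.1 hz
  exact mem_erase.2 ⟨fun e => hzi (by rw [e]), hzC⟩

theorem diffSet_sdiff_erase {i : Fin n} (hi : x i ≠ z i) :
    diffSet x z \ univ.erase i = {i} := by
  ext j
  simp only [mem_sdiff, mem_diffSet, mem_erase, mem_univ, and_true, not_not, mem_singleton]
  exact ⟨fun hj => hj.2, fun hj => ⟨hj ▸ hi, hj⟩⟩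

theorem IsWFP2.card_filter_ne_le {r : ℕ} (hn : n = 2 * r + 1) (h : IsWFP2 C) (hx : x ∈ C)
    (i : Fin n) : #(C.filter fun z => x i ≠ z i) ≤ (2 * r).choose r := by
  have := h.card_le_of_sdiff_eq hx (filter_ne_subset_erase C x i)
    (W := univ.erase i) (K := {i}) fun z hz => diffSet_sdiff_erase (mem_filter.1 hz).2
  simpa [card_erase_of_mem, hn] using this

/-- If two words at distance at most two exist, the code is small. -/
theorem IsWFP2.card_le_of_card_diffSet_le_two {r : ℕ} (hr : 1 ≤ r) (hn : n = 2 * r + 1)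
    (h : IsWFP2 C) (hx : x ∈ C) (hy : y ∈ C) (hxy : x ≠ y) (hd : #(diffSet x y) ≤ 2) :
    #C ≤ (2 * r).choose r + 2 := by
  have key : ∀ z ∈ C, z ≠ x → z ≠ y →
      ∃ p ∈ diffSet x y, ∃ q ∈ diffSet x y, p ∈ diffSet x z ∧ q ∉ diffSet x z := by
    intro z hz hzx hzy
    obtain ⟨p, hp, hp'⟩ := h.exists_mem_diffSet_inter hx hy hz hxy hzx.symm
    have : ¬ diffSet x y ⊆ diffSet x z := fun hs =>
      hzy (h.eq_of_diffSet_subset hx hz hy hxy.symm hs).symm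
    obtain ⟨q, hq, hq'⟩ := not_subset.1 this
    exact ⟨p, mem_diffSet.2 hp, q, hq, mem_diffSet.2 hp', hq'⟩
  by_cases hC : ∃ z ∈ C, z ≠ x ∧ z ≠ y
  · obtain ⟨z₀, hz₀, hz₀x, hz₀y⟩ := hC
    obtain ⟨p, hp, q, hq, hpz, hqz⟩ := key z₀ hz₀ hz₀x hz₀y
    have hpq : p ≠ q := fun e => hqz (e ▸ hpz)
    have hD : diffSet x y = {p, q} :=
      (eq_of_subset_of_card_le (by simp [insert_subset_iff, hp, hq])
        (by rwa [card_pair hpq])).symm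
    have bound : ∀ a b, a ≠ b → diffSet x y = {a, b} →
        #(C.filter fun z => a ∈ diffSet x z ∧ b ∉ diffSet x z) ≤ (2 * r - 1).choose (r - 1) := by
      intro a b hab hDab
      have := h.card_le_of_sdiff_eq hx (Z := C.filter fun z => a ∈ diffSet x z ∧ b ∉ diffSet x z)
        (W := (univ.erase a).erase b) (K := {a})
        (fun z hz => by
          obtain ⟨hzC, hza, -⟩ := mem_filter.1 hz
          exact filter_ne_subset_erase C x a (mem_filter.2 ⟨hzC, mem_diffSet.1 hza⟩))
        (fun z hz => by
          obtain ⟨hzC, hza, hzb⟩ := mem_filter.1 hz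
          ext j
          simp only [mem_sdiff, mem_erase, mem_univ, and_true, mem_singleton]
          constructor
          · rintro ⟨hj, hj'⟩
            by_contra hja
            exact hj' ⟨fun e => hzb (e ▸ hj), hja⟩
          · rintro rfl
            exact ⟨hza, fun hj => hj.2 rfl⟩)
      have hW : #((univ.erase a).erase b) = 2 * r - 1 := by
        rw [card_erase_of_mem (by simp [hab.symm]), card_erase_of_mem (by simp)]
        simp [hn]
      rwa [hW, show (2 * r - 1) / 2 = r - 1 by omega] at this
    have hcover : C ⊆ {x, y} ∪ (C.filter (fun z => p ∈ diffSet x z ∧ q ∉ diffSet x z) ∪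
        C.filter fun z => q ∈ diffSet x z ∧ p ∉ diffSet x z) := by
      intro z hz
      by_cases hzx : z = x
      · simp [hzx]
      by_cases hzy : z = y
      · simp [hzy]
      obtain ⟨a, ha, b, hb, haz, hbz⟩ := key z hz hzx hzy
      rw [hD, mem_insert, mem_singleton] at ha hb
      simp only [mem_union, mem_filter]
      rcases ha with rfl | rfl <;> rcases hb with rfl | rfl <;> tauto
    have h1 := bound p q hpq hD
    have h2 := bound q p hpq.symm (by rw [hD, pair_comm])
    have h3 := (card_le_card hcover).trans (card_union_le _ _)
    have h4 := card_union_le (C.filter fun z => p ∈ diffSet x z ∧ q ∉ diffSet x z)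
      (C.filter fun z => q ∈ diffSet x z ∧ p ∉ diffSet x z)
    have h5 : #({x, y} : Finset (Fin n → Q)) ≤ 2 := card_le_two
    have h6 : (2 * r).choose r = (2 * r - 1).choose (r - 1) + (2 * r - 1).choose (r - 1) := by
      obtain ⟨s, rfl⟩ := Nat.exists_eq_add_of_le' hr
      rw [show 2 * (s + 1) = 2 * s + 1 + 1 by ring, Nat.choose_succ_succ,
        Nat.choose_symm_half]
      simp
    omega
  · push Not at hC
    have : C ⊆ {x, y} := fun z hz => by
      by_cases hzx : z = x
      · simp [hzx]
      · simp [hC z hz hzx]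
    have := (card_le_card this).trans card_le_two
    omega

/-- In a large code, fewer than half of `(2 * r + 1).choose r` words differ from a given one
at a given position. -/
theorem IsWFP2.two_mul_card_filter_ne_le {r : ℕ} (hr : 1 ≤ r) (hn : n = 2 * r + 1)
    (h : IsWFP2 C) (hC : (2 * r).choose r + 2 < #C) (hx : x ∈ C) (i : Fin n) :
    2 * #(C.filter fun z => x i ≠ z i) ≤ (2 * r + 1).choose r := by
  obtain ⟨hinj, hanti⟩ := exists_antichain_subtype (Z := C.filter fun z => x i ≠ z i)
    (D := diffSet x) (W := univ.erase i) (K := {i})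
    (fun z hz => diffSet_sdiff_erase (mem_filter.1 hz).2)
    (fun y hy z hz => h.eq_of_diffSet_subset hx (mem_filter.1 hz).1 (mem_filter.1 hy).1
      fun e => (mem_filter.1 hy).2 (by rw [e]))
  rw [← card_image_of_injOn hinj]
  refine hanti.two_mul_card_le_of_compl_notMem hr (by simp [hn]) ?_
  intro A hA hAc
  obtain ⟨y, hy, rfl⟩ := mem_image.1 hA
  obtain ⟨z, hz, hzy⟩ := mem_image.1 hAc
  obtain ⟨hyC, hyi⟩ := mem_filter.1 hy
  obtain ⟨hzC, hzi⟩ := mem_filter.1 hz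
  have hyz : ∀ j, j ≠ i → y j ≠ z j := by
    intro j hj e
    have := congrArg ((⟨j, by simp [hj]⟩ : (univ.erase i : Finset (Fin n))) ∈ ·) hzy
    simp [e] at this
  have hsub : C.filter (fun w => ¬ y i ≠ w i) ⊆ {y, z} := by
    intro w hw
    obtain ⟨hwC, hwi⟩ := mem_filter.1 hw
    by_cases hwy : w = y
    · simp [hwy]
    have : w = z := h.eq_of_diffSet_subset hyC hzC hwC hwy fun j hj =>
      mem_diffSet.2 (hyz j fun e => hwi (e ▸ mem_diffSet.1 hj))
    simp [this]
  have h1 := (card_le_card hsub).trans card_le_two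
  have h2 := h.card_filter_ne_le hn hyC i
  have h3 := card_filter_add_card_filter_not (s := C) (fun w => y i ≠ w i)
  omega

/-- The Hamming bound for codes using at most two symbols per position and having minimum
distance at least three. -/
theorem card_mul_succ_le_two_pow
    (hbin : ∀ x ∈ C, ∀ y ∈ C, ∀ z ∈ C, ∀ i, x i = y i ∨ x i = z i ∨ y i = z i)
    (hdist : ∀ x ∈ C, ∀ y ∈ C, x ≠ y → 2 < #(diffSet x y)) : #C * (n + 1) ≤ 2 ^ n := by
  rcases C.eq_empty_or_nonempty with rfl | ⟨x, hx⟩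
  · simp
  let e : Option (Fin n) → Finset (Fin n) := fun o => o.elim ∅ fun i => {i}
  have he : Function.Injective e := by
    rintro (_ | i) (_ | j) hij
    · rfl
    · simp [e] at hij
    · simp [e] at hij
    · simpa [e] using hij
  have hecard : ∀ o, #(e o) ≤ 1 := by
    rintro (_ | i) <;> simp [e]
  have hsymm : ∀ y ∈ C, ∀ z ∈ C, diffSet y z = symmDiff (diffSet x y) (diffSet x z) := by
    intro y hy z hz
    ext i
    have := hbin x hx y hy z hz i
    simp only [mem_diffSet, mem_symmDiff]
    grind
  have hinj : Set.InjOn (fun p : (Fin n → Q) × Option (Fin n) => symmDiff (diffSet x p.1) (e p.2))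
      (C ×ˢ univ : Finset ((Fin n → Q) × Option (Fin n))) := by
    rintro ⟨y, o⟩ hy ⟨z, o'⟩ hz hyz
    have hyC : y ∈ C := (mem_product.1 hy).1
    have hzC : z ∈ C := (mem_product.1 hz).1
    change symmDiff (diffSet x y) (e o) = symmDiff (diffSet x z) (e o') at hyz
    have hsd : diffSet y z = symmDiff (e o) (e o') := by
      rw [hsymm y hyC z hzC]
      ext i
      have := congrArg (i ∈ ·) hyz
      simp only [mem_symmDiff] at this ⊢
      grind
    have hyz' : y = z := by
      by_contra hne
      have h1 := hdist y hyC z hzC hne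
      have h2 : #(diffSet y z) ≤ #(e o) + #(e o') := by
        rw [hsd]
        exact (card_le_card symmDiff_le_sup).trans (card_union_le _ _)
      have := hecard o
      have := hecard o'
      omega
    subst hyz'
    rw [he (symmDiff_right_injective _ hyz)]
  calc #C * (n + 1) = #(C ×ˢ (univ : Finset (Option (Fin n)))) := by simp [card_product]
    _ ≤ #(univ : Finset (Finset (Fin n))) :=
        card_le_card_of_injOn _ (fun _ _ => mem_coe.2 (mem_univ _)) hinj
    _ = 2 ^ n := by simp

theorem IsWFP2.card_le_or {r : ℕ} (hr : 1 ≤ r) (hn : n = 2 * r + 1) (h : IsWFP2 C) :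
    #C ≤ (2 * r).choose r + 2 ∨ 4 * #C ≤ 3 * (2 * r + 1).choose r ∨
      #C * (2 * r + 2) ≤ 2 ^ (2 * r + 1) := by
  by_contra! hcon
  obtain ⟨h1, h2, h3⟩ := hcon
  refine h3.not_ge ?_
  have hle := card_mul_succ_le_two_pow (C := C) ?_ ?_
  · simpa [hn] using hle
  · intro x hx y hy z hz i
    by_contra! hne
    obtain ⟨hxy, hxz, hyz⟩ := hne
    have hX := h.two_mul_card_filter_ne_le hr hn h1 hx i
    have hY := h.two_mul_card_filter_ne_le hr hn h1 hy i
    have hZ := h.two_mul_card_filter_ne_le hr hn h1 hz i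
    have hsum : 2 * #C ≤ #(C.filter fun w => x i ≠ w i) + #(C.filter fun w => y i ≠ w i) +
        #(C.filter fun w => z i ≠ w i) := by
      simp only [card_filter, ← sum_add_distrib]
      rw [mul_comm, ← smul_eq_mul]
      refine card_nsmul_le_sum _ _ _ fun w _ => ?_
      by_cases hxw : x i = w i <;> by_cases hyw : y i = w i <;> by_cases hzw : z i = w i <;>
        simp_all
    omega
  · intro x hx y hy hxy
    by_contra! hd
    exact h1.not_ge (h.card_le_of_card_diffSet_le_two hr hn hx hy hxy hd)

end Difference

theorem two_pow_le_two_add_mul_choose (r : ℕ) :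
    2 ^ (2 * r + 1) ≤ 2 + 2 * r * (2 * r + 1).choose r := by
  have h := Nat.sum_range_choose_halfway r
  rw [sum_range_succ'] at h
  have h' : ∑ i ∈ range r, (2 * r + 1).choose (i + 1) ≤ r * (2 * r + 1).choose r := by
    simpa using sum_le_card_nsmul (range r) (fun i => (2 * r + 1).choose (i + 1)) _ fun i hi =>
      Nat.choose_le_choose_of_le_half (j := r) (mem_range.1 hi) (by omega)
  rw [Nat.choose_zero_right] at h
  rw [pow_succ, pow_mul]
  norm_num at h ⊢
  nlinarith

/-- For odd `n ≥ 7` with `n ≡ 3 (mod 4)`, an `(n,m,q)` wide-sense 2-frameproof code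
satisfies `m ≤ C(n, (n-1)/2) - ((n+1)² - 8)/8 - ⌊(n-3)²/64⌋`. -/
theorem wfp2_upper_bound_odd_three_mod_four {n m q : ℕ} {Q : Type*} [Fintype Q]
    (hq : Fintype.card Q = q) (hq2 : 2 ≤ q)
    (hodd : Odd n) (hn7 : 7 ≤ n) (hmod : n % 4 = 3)
    (C : Finset (Fin n → Q)) (hC : C.card = m) (hwfp : IsWFP2 C) :
    m + ((n + 1) ^ 2 - 8) / 8 + (n - 3) ^ 2 / 64 ≤ n.choose ((n - 1) / 2) := by
  classical
  obtain ⟨k, rfl⟩ : ∃ k, n = 4 * k + 3 := ⟨n / 4, by omega⟩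
  have hk : 1 ≤ k := by omega
  have hmain := hwfp.card_le_or (r := 2 * k + 1) (by omega) (by ring)
  have hpow := two_pow_le_two_add_mul_choose (2 * k + 1)
  have hM := Nat.choose_two_mul_add_one (r := 2 * k + 1) (by omega)
  have hM3 : (2 * (2 * k + 1) + 1).choose 3 ≤ (2 * (2 * k + 1) + 1).choose (2 * k + 1) :=
    Nat.choose_le_choose_of_le_half (by omega) (by omega)
  have ha2 : (2 * (2 * k + 1)).choose 2 ≤ (2 * (2 * k + 1)).choose (2 * k + 1 - 1) :=
    Nat.choose_le_choose_of_le_half (by omega) (by omega)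
  have hc2 : (2 * (2 * k + 1)).choose 2 = (2 * k + 1) * (4 * k + 1) := by
    rw [Nat.choose_two_right, show 2 * (2 * k + 1) - 1 = 4 * k + 1 by omega, mul_assoc,
      Nat.mul_div_cancel_left _ two_pos]
  have hc3 : (2 * (2 * k + 1) + 1).choose 3 * 3 = (4 * k + 3) * ((2 * k + 1) * (4 * k + 1)) := by
    rw [← hc2, ← Nat.add_one_mul_choose_eq]
    ring
  have he1 : ((4 * k + 3 + 1) ^ 2 - 8) / 8 = 2 * (k + 1) ^ 2 - 1 := by
    rw [show (4 * k + 3 + 1) ^ 2 = 8 * (2 * (k + 1) ^ 2) by ring]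
    omega
  have he2 : 4 * ((4 * k + 3 - 3) ^ 2 / 64) ≤ k ^ 2 := by
    rw [Nat.add_sub_cancel, show (4 * k) ^ 2 = 16 * k ^ 2 by ring]
    omega
  rw [hC] at hmain
  rw [he1, show (4 * k + 3 - 1) / 2 = 2 * k + 1 by omega]
  rw [show 2 * (2 * k + 1) + 1 = 4 * k + 3 by ring] at *
  generalize (4 * k + 3 - 3) ^ 2 / 64 = f at *
  obtain ⟨g, hg⟩ : ∃ g, 2 * (k + 1) ^ 2 = g + 1 := ⟨2 * (k + 1) ^ 2 - 1, by
    have : 0 < (k + 1) ^ 2 := by positivity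
    omega⟩
  rw [hg, Nat.add_sub_cancel]
  generalize (4 * k + 3).choose (2 * k + 1) = M at *
  generalize (4 * k + 3).choose 3 = M3 at *
  generalize (2 * (2 * k + 1)).choose (2 * k + 1) = b at *
  generalize (2 * (2 * k + 1)).choose (2 * k + 1 - 1) = a at *
  rcases hmain with h | h | h
  · nlinarith
  · nlinarith
  · have h' : m * (2 * k + 2) ≤ 1 + (2 * k + 1) * M := by nlinarith
    have h6 : 1 + (g + f) * (2 * k + 2) ≤ M := by nlinarith
    refine le_of_mul_le_mul_right (a := 2 * k + 2) ?_ (by omega)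
    nlinarith
end

section
/- Let n ≥ 6 be even and let F be a nonempty non 2-covering Sperner family of subsets of [n]. If the minimum size l of a member of F satisfies l ≤ n/2 − 2, then |F| ≤ (n choose n/2 − 1) − n/2 − 1. -/
/-- A family of subsets is a Sperner family (antichain): no member is a subset of
another member unless they are equal. -/
def IsSperner {n : ℕ} (F : Finset (Finset (Fin n))) : Prop :=
  ∀ A ∈ F, ∀ B ∈ F, A ⊆ B → A = B

/-- A family is non 2-covering if no two (not necessarily distinct) members
have union equal to the whole ground set. -/
def NonTwoCovering {n : ℕ} (F : Finset (Finset (Fin n))) : Prop :=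
  ∀ A ∈ F, ∀ B ∈ F, A ∪ B ≠ Finset.univ

section

open Finset FinsetFamily

/-- Initial segments of the colexicographic order exist in every possible cardinality. -/
theorem exists_isInitSeg_card_eq {n r k : ℕ} (hk : k ≤ n.choose r) :
    ∃ C : Finset (Finset (Fin n)), Colex.IsInitSeg C r ∧ #C = k := by
  induction k with
  | zero => exact ⟨∅, Colex.isInitSeg_empty, rfl⟩
  | succ k ih =>
    obtain ⟨C, hC, hCk⟩ := ih (by omega)
    have hne : (powersetCard r univ \ C).Nonempty := by
      rw [← card_pos]
      have := le_card_sdiff C (powersetCard r (univ : Finset (Fin n)))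
      rw [card_powersetCard, card_univ, Fintype.card_fin] at this
      omega
    obtain ⟨s, hs, hmin⟩ := exists_min_image _ toColex hne
    rw [mem_sdiff, mem_powersetCard_univ] at hs
    refine ⟨insert s C, ⟨?_, ?_⟩, by rw [card_insert_of_notMem hs.2, hCk]⟩
    · intro x hx
      rw [mem_coe, mem_insert] at hx
      rcases hx with rfl | hx
      exacts [hs.1, hC.1 hx]
    · rintro x t hx ⟨htx, htr⟩
      rcases mem_insert.1 hx with rfl | hx
      · by_contra ht
        rw [mem_insert, not_or] at ht
        exact (hmin t (mem_sdiff.2 ⟨mem_powersetCard_univ.2 htr, ht.2⟩)).not_gt htx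
      · exact mem_insert_of_mem (hC.2 hx ⟨htx, htr⟩)

/-- A local LYM inequality for families whose members all avoid a common point. -/
theorem card_mul_le_card_shadow_mul_of_forall_notMem {n r : ℕ} {C : Finset (Finset (Fin n))}
    (hC : (C : Set (Finset (Fin n))).Sized r) (x : Fin n) (hx : ∀ s ∈ C, x ∉ s) :
    #C * r ≤ #(∂ C) * (n - r) := by
  refine card_mul_le_card_mul (fun s t ↦ t ⊆ s) (fun s hs ↦ ?_) (fun t ht ↦ ?_)
  · rw [← hC hs, ← card_image_of_injOn s.erase_injOn]
    refine card_le_card fun t ht ↦ ?_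
    obtain ⟨a, ha, rfl⟩ := mem_image.1 ht
    exact (mem_bipartiteAbove _).2 ⟨erase_mem_shadow hs ha, erase_subset _ _⟩
  · obtain ⟨a, hat, hs⟩ := mem_shadow_iff_insert_mem.1 ht
    have hcard := hC hs
    rw [card_insert_of_notMem hat] at hcard
    have hxt : x ∉ t := fun h ↦ hx _ hs (mem_insert_of_mem h)
    have hle : #((insert x t)ᶜ.image fun b ↦ insert b t) ≤ n - r := by
      refine card_image_le.trans ?_
      rw [card_compl, card_insert_of_notMem hxt, Fintype.card_fin, hcard]
    refine (card_le_card fun s hs ↦ ?_).trans hle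
    obtain ⟨hsC, hts⟩ := (mem_bipartiteBelow _).1 hs
    have hsr := hC hsC
    obtain ⟨b, hb, rfl⟩ := exists_eq_insert_iff.2 ⟨hts, by omega⟩
    refine mem_image.2 ⟨b, mem_compl.2 fun h ↦ ?_, rfl⟩
    rcases mem_insert.1 h with rfl | h
    exacts [hx _ hsC (mem_insert_self _ _), hb h]

/-- A family of `r`-sets, no larger than the family of all `r`-sets avoiding a point, has a shadow
at least as large as itself, provided `n ≤ 2 * r`. -/
theorem card_le_card_shadow_of_card_le_choose {n r : ℕ} (hr : 0 < r) (hrn : r ≤ n)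
    (hn : n ≤ 2 * r) {G : Finset (Finset (Fin n))} (hG : (G : Set (Finset (Fin n))).Sized r)
    (hcard : #G ≤ (n - 1).choose r) : #G ≤ #(∂ G) := by
  obtain ⟨C, hC, hCG⟩ := exists_isInitSeg_card_eq
    (hcard.trans (Nat.choose_le_choose r (Nat.sub_le n 1)))
  let x : Fin n := ⟨n - 1, by omega⟩
  have hx : ∀ s ∈ C, x ∉ s := by
    intro s hs hxs
    have hsub : insert s (powersetCard r (univ.erase x)) ⊆ C := by
      refine insert_subset hs fun t ht ↦ ?_
      rw [mem_powersetCard] at ht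
      have hxt : x ∉ t := fun h ↦ notMem_erase x univ (ht.1 h)
      refine hC.2 hs ⟨Colex.toColex_lt_toColex.2 ⟨?_, fun a _ _ ↦ ⟨x, hxs, hxt, ?_⟩⟩, ht.2⟩
      · rintro rfl
        exact hxt hxs
      · exact Fin.le_def.2 (Nat.le_sub_one_of_lt a.2)
    have := card_le_card hsub
    rw [card_insert_of_notMem, card_powersetCard, card_erase_of_mem (mem_univ x), card_univ,
      Fintype.card_fin] at this
    · omega
    · intro h
      exact notMem_erase x univ ((mem_powersetCard.1 h).1 hxs)
  have hmul := card_mul_le_card_shadow_mul_of_forall_notMem hC.1 x hx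
  have hle : #C ≤ #(∂ C) :=
    Nat.le_of_mul_le_mul_right (hmul.trans (Nat.mul_le_mul_left _ (by omega))) hr
  exact hCG ▸ hle.trans (kruskal_katona hG hCG.le hC)

/-- The shadow of a level `k ≥ n / 2` of a non 2-covering family is at least as large as the
level. -/
theorem NonTwoCovering.card_le_card_shadow {n k : ℕ} {G : Finset (Finset (Fin n))}
    (hc : NonTwoCovering G) (hG : (G : Set (Finset (Fin n))).Sized k) (hk0 : 0 < k)
    (hk : n ≤ 2 * k) : #G ≤ #(∂ G) := by
  rcases G.eq_empty_or_nonempty with rfl | ⟨A, hA⟩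
  · simp
  have hkn : k ≤ n := by simpa [hG hA] using card_le_univ A
  rcases hk.eq_or_lt with rfl | hk
  · have hint : (G : Set (Finset (Fin (2 * k)))).Intersecting := by
      intro A hA B hB hAB
      refine hc A hA B hB ((card_eq_iff_eq_univ _).1 ?_)
      rw [card_union_of_disjoint hAB, hG hA, hG hB, Fintype.card_fin, two_mul]
    have hekr := erdos_ko_rado hint hG (by omega)
    refine card_le_card_shadow_of_card_le_choose hk0 hkn le_rfl hG (hekr.trans_eq ?_)
    exact Nat.choose_symm_of_eq_add (by omega)
  · have hlym := card_mul_le_card_shadow_mul hG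
    rw [Fintype.card_fin] at hlym
    exact Nat.le_of_mul_le_mul_right (hlym.trans (Nat.mul_le_mul_left _ (by omega))) hk0

/-- A nonempty family of `j`-sets, with `j` below the middle, has an upper shadow exceeding it by
at least `n - j - 1`, the excess for a single set. -/
theorem card_add_le_card_upShadow_add_one {n j : ℕ} (hj : 2 * j + 2 ≤ n)
    {G : Finset (Finset (Fin n))} (hG : (G : Set (Finset (Fin n))).Sized j) (hne : G.Nonempty) :
    #G + (n - j) ≤ #(∂⁺ G) + 1 := by
  obtain ⟨A, hA⟩ := hne
  have hAbove : n - j ≤ #{T ∈ ∂⁺ G | A ⊆ T} := by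
    have hcard : #(Aᶜ.image fun a ↦ insert a A) = n - j := by
      rw [card_image_of_injOn, card_compl, hG hA, Fintype.card_fin]
      intro a ha b _ hab
      exact (insert_inj (mem_compl.1 ha)).1 hab
    rw [← hcard]
    refine card_le_card fun T hT ↦ ?_
    obtain ⟨a, ha, rfl⟩ := mem_image.1 hT
    exact mem_filter.2 ⟨insert_mem_upShadow hA (mem_compl.1 ha), subset_insert _ _⟩
  have hRest : #(G.erase A) * (n - j - 1) ≤ #{T ∈ ∂⁺ G | ¬A ⊆ T} * (j + 1) := by
    refine card_mul_le_card_mul (fun B T ↦ B ⊆ T) (fun B hB ↦ ?_) (fun T hT ↦ ?_)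
    · obtain ⟨hBA, hB⟩ := mem_erase.1 hB
      obtain ⟨y, hyA, hyB⟩ := not_subset.1 fun h : A ⊆ B ↦
        hBA (eq_of_subset_of_card_le h (by rw [hG hA, hG hB])).symm
      have hcard : #((Bᶜ.erase y).image fun a ↦ insert a B) = n - j - 1 := by
        rw [card_image_of_injOn, card_erase_of_mem (mem_compl.2 hyB), card_compl, hG hB,
          Fintype.card_fin]
        intro a ha b _ hab
        exact (insert_inj (mem_compl.1 (mem_of_mem_erase ha))).1 hab
      rw [← hcard]
      refine card_le_card fun T hT ↦ ?_
      obtain ⟨a, ha, rfl⟩ := mem_image.1 hT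
      obtain ⟨hay, ha⟩ := mem_erase.1 ha
      refine (mem_bipartiteAbove _).2 ⟨mem_filter.2 ⟨insert_mem_upShadow hB (mem_compl.1 ha),
        fun h ↦ ?_⟩, subset_insert _ _⟩
      rcases mem_insert.1 (h hyA) with h | h
      exacts [hay h.symm, hyB h]
    · have hTcard : #T = j + 1 := hG.upShadow (mem_filter.1 hT).1
      have hcard : #(powersetCard j T) = j + 1 := by
        rw [card_powersetCard, hTcard, Nat.choose_succ_self_right]
      rw [← hcard]
      refine card_le_card fun B hB ↦ ?_
      obtain ⟨hB, hBT⟩ := (mem_bipartiteBelow _).1 hB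
      exact mem_powersetCard.2 ⟨hBT, hG (mem_of_mem_erase hB)⟩
  have hRest' : #(G.erase A) ≤ #{T ∈ ∂⁺ G | ¬A ⊆ T} := by
    refine Nat.le_of_mul_le_mul_right (hRest.trans (Nat.mul_le_mul_left _ ?_))
      (show 0 < n - j - 1 by omega)
    omega
  have hsplit := card_filter_add_card_filter_not (s := ∂⁺ G) (fun T ↦ A ⊆ T)
  have herase := card_erase_add_one hA
  omega

/-- Replace the members of size `j` by their upper shadow. -/
def raiseLevel {n : ℕ} (F : Finset (Finset (Fin n))) (j : ℕ) : Finset (Finset (Fin n)) :=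
  {A ∈ F | #A ≠ j} ∪ ∂⁺ {A ∈ F | #A = j}

/-- Replace the members of size `k` by their shadow. -/
def lowerLevel {n : ℕ} (F : Finset (Finset (Fin n))) (k : ℕ) : Finset (Finset (Fin n)) :=
  {A ∈ F | #A ≠ k} ∪ ∂ {A ∈ F | #A = k}

theorem sized_filter_card_eq {n : ℕ} (F : Finset (Finset (Fin n))) (k : ℕ) :
    (({A ∈ F | #A = k} : Finset (Finset (Fin n))) : Set (Finset (Fin n))).Sized k :=
  fun _ hA ↦ (mem_filter.1 hA).2

theorem mem_raiseLevel {n j : ℕ} {F : Finset (Finset (Fin n))} {A : Finset (Fin n)} :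
    A ∈ raiseLevel F j ↔
      A ∈ F ∧ #A ≠ j ∨ #A = j + 1 ∧ ∃ B ∈ F, #B = j ∧ B ⊆ A := by
  rw [raiseLevel, mem_union, mem_filter, mem_upShadow_iff_exists_mem_card_add_one]
  grind

theorem mem_lowerLevel {n k : ℕ} {F : Finset (Finset (Fin n))} {A : Finset (Fin n)} :
    A ∈ lowerLevel F k ↔
      A ∈ F ∧ #A ≠ k ∨ #A + 1 = k ∧ ∃ B ∈ F, #B = k ∧ A ⊆ B := by
  rw [lowerLevel, mem_union, mem_filter, mem_shadow_iff_exists_mem_card_add_one]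
  grind

theorem IsSperner.raiseLevel {n j : ℕ} {F : Finset (Finset (Fin n))} (hS : IsSperner F)
    (hF : ∀ A ∈ F, j ≤ #A) : IsSperner (raiseLevel F j) := by
  intro X hX Y hY hXY
  rcases mem_raiseLevel.1 hX with ⟨hX, hXj⟩ | ⟨hXj, B, hB, hBj, hBX⟩ <;>
    rcases mem_raiseLevel.1 hY with ⟨hY, hYj⟩ | ⟨hYj, -⟩
  · exact hS X hX Y hY hXY
  · have := hF X hX
    exact eq_of_subset_of_card_le hXY (by omega)
  · exact absurd (hS B hB Y hY (hBX.trans hXY) ▸ hBj) hYj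
  · exact eq_of_subset_of_card_le hXY (by omega)

theorem IsSperner.lowerLevel {n k : ℕ} {F : Finset (Finset (Fin n))} (hS : IsSperner F)
    (hF : ∀ A ∈ F, #A ≤ k) : IsSperner (lowerLevel F k) := by
  intro X hX Y hY hXY
  rcases mem_lowerLevel.1 hX with ⟨hX, hXk⟩ | ⟨hXk, -⟩ <;>
    rcases mem_lowerLevel.1 hY with ⟨hY, hYk⟩ | ⟨hYk, B, hB, hBk, hYB⟩
  · exact hS X hX Y hY hXY
  · exact absurd (hS X hX B hB (hXY.trans hYB) ▸ hBk) hXk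
  · have := hF Y hY
    exact eq_of_subset_of_card_le hXY (by omega)
  · exact eq_of_subset_of_card_le hXY (by omega)

theorem IsSperner.card_raiseLevel {n : ℕ} {F : Finset (Finset (Fin n))} (hS : IsSperner F)
    (j : ℕ) : #(_root_.raiseLevel F j) + #{A ∈ F | #A = j} =
      #F + #(∂⁺ {A ∈ F | #A = j}) := by
  have hdisj : Disjoint {A ∈ F | #A ≠ j} (∂⁺ {A ∈ F | #A = j}) := by
    refine disjoint_left.2 fun A hA hA' ↦ ?_
    obtain ⟨B, hB, hBA⟩ := exists_subset_of_mem_upShadow hA'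
    rw [mem_filter] at hA hB
    exact hA.2 (hS B hB.1 A hA.1 hBA ▸ hB.2)
  have hsplit : #{A ∈ F | #A = j} + #{A ∈ F | #A ≠ j} = #F := card_filter_add_card_filter_not _
  rw [_root_.raiseLevel, card_union_of_disjoint hdisj]
  omega

theorem IsSperner.card_lowerLevel {n : ℕ} {F : Finset (Finset (Fin n))} (hS : IsSperner F)
    (k : ℕ) : #(_root_.lowerLevel F k) + #{A ∈ F | #A = k} =
      #F + #(∂ {A ∈ F | #A = k}) := by
  have hdisj : Disjoint {A ∈ F | #A ≠ k} (∂ {A ∈ F | #A = k}) := by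
    refine disjoint_left.2 fun A hA hA' ↦ ?_
    obtain ⟨B, hB, hAB⟩ := exists_subset_of_mem_shadow hA'
    rw [mem_filter] at hA hB
    exact hA.2 (hS A hA.1 B hB.1 hAB ▸ hB.2)
  have hsplit : #{A ∈ F | #A = k} + #{A ∈ F | #A ≠ k} = #F := card_filter_add_card_filter_not _
  rw [_root_.lowerLevel, card_union_of_disjoint hdisj]
  omega

theorem NonTwoCovering.lowerLevel {n : ℕ} {F : Finset (Finset (Fin n))} (hc : NonTwoCovering F)
    (k : ℕ) : NonTwoCovering (lowerLevel F k) := by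
  have hsub : ∀ A ∈ _root_.lowerLevel F k, ∃ B ∈ F, A ⊆ B := by
    intro A hA
    rcases mem_lowerLevel.1 hA with ⟨hA, -⟩ | ⟨-, B, hB, -, hAB⟩
    exacts [⟨A, hA, Subset.rfl⟩, ⟨B, hB, hAB⟩]
  intro A hA B hB hAB
  obtain ⟨A', hA', hAA'⟩ := hsub A hA
  obtain ⟨B', hB', hBB'⟩ := hsub B hB
  exact hc A' hA' B' hB' (univ_subset_iff.1 (hAB ▸ union_subset_union hAA' hBB'))

/-- The bound for Sperner families living on levels `j, …, m + 1` with `j ≤ m` attained, where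
level `m + 1` lies below the middle. -/
theorem IsSperner.card_add_le_choose {n m j : ℕ} (hm : 2 * m + 2 ≤ n) (hjm : j ≤ m)
    {F : Finset (Finset (Fin n))} (hS : IsSperner F) (hlow : ∀ A ∈ F, j ≤ #A)
    (hup : ∀ A ∈ F, #A ≤ m + 1) (hj : ∃ A ∈ F, #A = j) :
    #F + (n - m) ≤ n.choose (m + 1) + 1 := by
  induction hd : m - j generalizing j F with
  | zero =>
    obtain rfl : j = m := by omega
    obtain ⟨A, hA, hAj⟩ := hj
    have hshadow := card_add_le_card_upShadow_add_one hm (sized_filter_card_eq F j)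
      ⟨A, mem_filter.2 ⟨hA, hAj⟩⟩
    have hcard := hS.card_raiseLevel j
    have hle : #(_root_.raiseLevel F j) ≤ #(powersetCard (j + 1) (univ : Finset (Fin n))) := by
      refine card_le_card fun X hX ↦ mem_powersetCard_univ.2 ?_
      rcases mem_raiseLevel.1 hX with ⟨hX, hXj⟩ | ⟨hXj, -⟩
      · have := hlow X hX
        have := hup X hX
        omega
      · exact hXj
    rw [card_powersetCard, card_univ, Fintype.card_fin] at hle
    omega
  | succ d ih =>
    obtain ⟨A, hA, hAj⟩ := hj
    have hshadow := card_add_le_card_upShadow_add_one (by omega) (sized_filter_card_eq F j)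
      ⟨A, mem_filter.2 ⟨hA, hAj⟩⟩
    have hcard := hS.card_raiseLevel j
    obtain ⟨a, ha⟩ : ∃ a, a ∉ A := by
      by_contra! h
      rw [(eq_univ_iff_forall.2 h), card_univ, Fintype.card_fin] at hAj
      omega
    have := ih (j := j + 1) (by omega) (hS.raiseLevel hlow) (fun X hX ↦ ?_) (fun X hX ↦ ?_)
      ⟨insert a A, mem_raiseLevel.2 (Or.inr ⟨by rw [card_insert_of_notMem ha, hAj],
        A, hA, hAj, subset_insert _ _⟩), by rw [card_insert_of_notMem ha, hAj]⟩ (by omega)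
    · omega
    · rcases mem_raiseLevel.1 hX with ⟨hX, hXj⟩ | ⟨hXj, -⟩
      · have := hlow X hX
        omega
      · omega
    · rcases mem_raiseLevel.1 hX with ⟨hX, -⟩ | ⟨hXj, -⟩
      · exact hup X hX
      · omega

/-- The bound for non 2-covering Sperner families with a smallest member of size `j ≤ m`, where
`n = 2 * (m + 2)`. -/
theorem IsSperner.card_add_le_choose_of_nonTwoCovering {n m j k : ℕ} (hn : n = 2 * (m + 2))
    (hjm : j ≤ m) (hmk : m + 1 ≤ k) {F : Finset (Finset (Fin n))} (hS : IsSperner F)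
    (hc : NonTwoCovering F) (hlow : ∀ A ∈ F, j ≤ #A) (hup : ∀ A ∈ F, #A ≤ k)
    (hj : ∃ A ∈ F, #A = j) : #F + (n - m) ≤ n.choose (m + 1) + 1 := by
  induction k, hmk using Nat.le_induction generalizing F with
  | base => exact hS.card_add_le_choose (by omega) hjm hlow hup hj
  | succ k hmk ih =>
    have hshadow : #{A ∈ F | #A = k + 1} ≤ #(∂ {A ∈ F | #A = k + 1}) :=
      NonTwoCovering.card_le_card_shadow
        (fun A hA B hB ↦ hc A (mem_filter.1 hA).1 B (mem_filter.1 hB).1)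
        (sized_filter_card_eq F (k + 1)) (by omega) (by omega)
    have hcard := hS.card_lowerLevel (k + 1)
    obtain ⟨A, hA, hAj⟩ := hj
    have := ih (hS.lowerLevel hup) (hc.lowerLevel (k + 1)) (fun X hX ↦ ?_) (fun X hX ↦ ?_)
      ⟨A, mem_lowerLevel.2 (Or.inl ⟨hA, by omega⟩), hAj⟩
    · omega
    · rcases mem_lowerLevel.1 hX with ⟨hX, -⟩ | ⟨hXk, -⟩
      · exact hlow X hX
      · omega
    · rcases mem_lowerLevel.1 hX with ⟨hX, hXk⟩ | ⟨hXk, -⟩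
      · have := hup X hX
        omega
      · omega

end

/-- For even `n ≥ 6`, a nonempty non 2-covering Sperner family whose minimum member
size `l` satisfies `l ≤ n/2 - 2` has `|F| ≤ C(n, n/2 - 1) - n/2 - 1`. -/
theorem non_two_covering_sperner_min_small {n l : ℕ} (hn : Even n) (hn6 : 6 ≤ n)
    (F : Finset (Finset (Fin n))) (hne : F.Nonempty)
    (hS : IsSperner F) (hc : NonTwoCovering F)
    (hlmin : ∀ A ∈ F, l ≤ A.card) (hlatt : ∃ A ∈ F, A.card = l)
    (hl : l ≤ n / 2 - 2) :
    F.card + n / 2 + 1 ≤ n.choose (n / 2 - 1) := by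
  obtain ⟨t, rfl⟩ := hn
  obtain ⟨m, rfl⟩ : ∃ m, t = m + 2 := ⟨t - 2, by omega⟩
  have hbound := hS.card_add_le_choose_of_nonTwoCovering (m := m) (k := m + 2 + (m + 2))
    (by omega) (by omega) (by omega) hc hlmin (fun A _ ↦ by simpa using Finset.card_le_univ A)
    hlatt
  have hhalf : (m + 2 + (m + 2)) / 2 - 1 = m + 1 := by omega
  rw [hhalf]
  omega
end

section
/- Let n be odd and let F be a nonempty Sperner family of subsets of [n]; let l and u be the minimum and maximum sizes of members of F. If l < (n−1)/2 and u > (n+1)/2, then |F| ≤ (n choose (n−1)/2) − (u−l−1)·(n+1)/2 − ⌊(u−l−2)²/4⌋. -/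
section UpShadow

variable {α : Type*} [DecidableEq α]

/-- The upper shadow of a set family relative to a ground set `U`. -/
def upShadowIn (U : Finset α) (A : Finset (Finset α)) : Finset (Finset α) :=
  A.biUnion fun B => (U \ B).image fun a => insert a B

theorem mem_upShadowIn {U : Finset α} {A : Finset (Finset α)} {C : Finset α} :
    C ∈ upShadowIn U A ↔ ∃ B ∈ A, ∃ a ∈ U, a ∉ B ∧ insert a B = C := by
  simp [upShadowIn, and_assoc]

/-- Double counting of the covering relation between a uniform family in the interval `[T, U]`
and its upper shadow. -/
theorem card_le_card_upShadowIn {T U : Finset α} {k : ℕ} {A : Finset (Finset α)}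
    (hT : ∀ B ∈ A, T ⊆ B) (hU : ∀ B ∈ A, B ⊆ U) (hk : ∀ B ∈ A, B.card = k)
    (h : 2 * k + 1 ≤ U.card + T.card) : A.card ≤ (upShadowIn U A).card := by
  rcases A.eq_empty_or_nonempty with rfl | ⟨B₀, hB₀⟩
  · simp
  have hTk : T.card ≤ k := hk B₀ hB₀ ▸ Finset.card_le_card (hT B₀ hB₀)
  have key := Finset.card_mul_le_card_mul (s := A) (t := upShadowIn U A)
    (m := U.card - k) (n := k + 1 - T.card) (· ⊆ ·) ?_ ?_
  · refine Nat.le_of_mul_le_mul_right (key.trans (Nat.mul_le_mul_left _ ?_) :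
      A.card * (U.card - k) ≤ (upShadowIn U A).card * (U.card - k)) ?_ <;> omega
  · intro B hB
    have hcard : ((U \ B).image fun a => insert a B).card = U.card - k := by
      rw [Finset.card_image_of_injOn, Finset.card_sdiff_of_subset (hU B hB), hk B hB]
      intro a ha b hb hab
      exact (Finset.insert_inj (Finset.mem_sdiff.1 ha).2).1 hab
    rw [← hcard]
    refine Finset.card_le_card fun C hC => ?_
    obtain ⟨a, ha, rfl⟩ := Finset.mem_image.1 hC
    rw [Finset.mem_sdiff] at ha
    exact (Finset.mem_bipartiteAbove _).2
      ⟨mem_upShadowIn.2 ⟨B, hB, a, ha.1, ha.2, rfl⟩, Finset.subset_insert _ _⟩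
  · intro C hC
    obtain ⟨B, hB, a, -, haB, rfl⟩ := mem_upShadowIn.1 hC
    have hTC : T ⊆ insert a B := (hT B hB).trans (Finset.subset_insert _ _)
    have hcard : (insert a B).card = k + 1 := by
      rw [Finset.card_insert_of_notMem haB, hk B hB]
    calc _ ≤ ((insert a B \ T).image fun b => (insert a B).erase b).card := by
            refine Finset.card_le_card fun D hD => ?_
            obtain ⟨hDA, hDC⟩ := (Finset.mem_bipartiteBelow _).1 hD
            have hsub : (insert a B \ D).card = 1 := by
              rw [Finset.card_sdiff_of_subset hDC, hcard, hk D hDA]; omega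
            obtain ⟨b, hb⟩ := Finset.card_eq_one.1 hsub
            have hb' : b ∈ insert a B \ D := hb ▸ Finset.mem_singleton_self b
            rw [Finset.mem_sdiff] at hb'
            refine Finset.mem_image.2
              ⟨b, Finset.mem_sdiff.2 ⟨hb'.1, fun hbT => hb'.2 (hT D hDA hbT)⟩, ?_⟩
            rw [← Finset.sdiff_singleton_eq_erase, ← hb, Finset.sdiff_sdiff_eq_self hDC]
      _ ≤ (insert a B \ T).card := Finset.card_image_le
      _ = k + 1 - T.card := by rw [Finset.card_sdiff_of_subset hTC, hcard]

/-- Among nonempty families of `k`-sets in `[T, U]`, at low enough level, singletons have the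
smallest expansion. -/
theorem card_add_le_card_upShadowIn {U : Finset α} {k : ℕ} (d : ℕ) :
    ∀ {T : Finset α} {A : Finset (Finset α)}, A.Nonempty → T.card + d = k →
      (∀ B ∈ A, T ⊆ B) → (∀ B ∈ A, B ⊆ U) → (∀ B ∈ A, B.card = k) →
      2 * k + 2 ≤ U.card + T.card → A.card + U.card ≤ (upShadowIn U A).card + k + 1 := by
  induction d with
  | zero =>
    intro T A hA hTk hT hU hk h
    have hAT : A = {T} := by
      refine Finset.eq_singleton_iff_nonempty_unique_mem.2 ⟨hA, fun B hB => ?_⟩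
      exact (Finset.eq_of_subset_of_card_le (hT B hB) (by rw [hk B hB]; omega)).symm
    subst hAT
    have hTU := hU T (Finset.mem_singleton_self T)
    have hcard : (upShadowIn U {T}).card = U.card - T.card := by
      rw [upShadowIn, Finset.singleton_biUnion, Finset.card_image_of_injOn,
        Finset.card_sdiff_of_subset hTU]
      intro a ha b hb hab
      exact (Finset.insert_inj (Finset.mem_sdiff.1 ha).2).1 hab
    rw [hcard, Finset.card_singleton]
    omega
  | succ d ih =>
    intro T A ⟨S, hS⟩ hTk hT hU hk h
    obtain ⟨x, hxS, hxT⟩ : ∃ x ∈ S, x ∉ T :=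
      Finset.exists_mem_notMem_of_card_lt_card (by rw [hk S hS]; omega)
    have hxU := hU S hS hxS
    have hins : (insert x T).card = T.card + 1 := Finset.card_insert_of_notMem hxT
    have hmem := ih (T := insert x T) (A := A.filter (x ∈ ·))
      ⟨S, Finset.mem_filter.2 ⟨hS, hxS⟩⟩ (by omega)
      (fun B hB => Finset.insert_subset (Finset.mem_filter.1 hB).2
        (hT B (Finset.mem_filter.1 hB).1))
      (fun B hB => hU B (Finset.mem_filter.1 hB).1)
      (fun B hB => hk B (Finset.mem_filter.1 hB).1) (by omega)
    have hnot := card_le_card_upShadowIn (T := T) (U := U.erase x) (k := k)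
      (A := A.filter (x ∉ ·))
      (fun B hB => hT B (Finset.mem_filter.1 hB).1)
      (fun B hB => Finset.subset_erase.2
        ⟨hU B (Finset.mem_filter.1 hB).1, (Finset.mem_filter.1 hB).2⟩)
      (fun B hB => hk B (Finset.mem_filter.1 hB).1)
      (by rw [Finset.card_erase_of_mem hxU]; omega)
    have hdisj : Disjoint (upShadowIn U (A.filter (x ∈ ·)))
        (upShadowIn (U.erase x) (A.filter (x ∉ ·))) := by
      refine Finset.disjoint_left.2 fun C hC hC' => ?_
      obtain ⟨B, hB, a, -, -, rfl⟩ := mem_upShadowIn.1 hC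
      obtain ⟨B', hB', a', ha', -, h'⟩ := mem_upShadowIn.1 hC'
      have hx : x ∈ insert a' B' :=
        h' ▸ Finset.mem_insert_of_mem (Finset.mem_filter.1 hB).2
      rcases Finset.mem_insert.1 hx with rfl | hx
      · exact Finset.notMem_erase _ _ ha'
      · exact (Finset.mem_filter.1 hB').2 hx
    have hsub : upShadowIn U (A.filter (x ∈ ·)) ∪ upShadowIn (U.erase x) (A.filter (x ∉ ·)) ⊆
        upShadowIn U A := by
      refine Finset.union_subset (fun C hC => ?_) fun C hC => ?_
      · obtain ⟨B, hB, a, ha, haB, rfl⟩ := mem_upShadowIn.1 hC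
        exact mem_upShadowIn.2 ⟨B, (Finset.mem_filter.1 hB).1, a, ha, haB, rfl⟩
      · obtain ⟨B, hB, a, ha, haB, rfl⟩ := mem_upShadowIn.1 hC
        exact mem_upShadowIn.2
          ⟨B, (Finset.mem_filter.1 hB).1, a, Finset.mem_of_mem_erase ha, haB, rfl⟩
    have hle := Finset.card_le_card hsub
    rw [Finset.card_union_of_disjoint hdisj] at hle
    have hsplit := Finset.card_filter_add_card_filter_not (s := A) (x ∈ ·)
    omega

end UpShadow

/-- Replace the lowest level of a Sperner family by its upper shadow. -/
theorem IsSperner.exists_replace_min_level {n l : ℕ} {F : Finset (Finset (Fin n))}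
    (hS : IsSperner F) (hmin : ∀ A ∈ F, l ≤ A.card) (hatt : ∃ A ∈ F, A.card = l)
    (hl : 2 * l + 2 ≤ n) :
    ∃ G : Finset (Finset (Fin n)), IsSperner G ∧ (∀ A ∈ G, l + 1 ≤ A.card) ∧
      (∃ A ∈ G, A.card = l + 1) ∧ F.card + n ≤ G.card + l + 1 ∧
      (∀ A ∈ G, A.card ≤ l + 1 ∨ A ∈ F) ∧ (∀ A ∈ F, l < A.card → A ∈ G) := by
  set L := F.filter (·.card = l)
  set H := F.filter (¬ ·.card = l)
  have hup : ∀ C ∈ upShadowIn Finset.univ L, C.card = l + 1 ∧ ∃ B ∈ F, B.card = l ∧ B ⊆ C := by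
    intro C hC
    obtain ⟨B, hB, a, -, haB, rfl⟩ := mem_upShadowIn.1 hC
    obtain ⟨hBF, hBl⟩ := Finset.mem_filter.1 hB
    exact ⟨by rw [Finset.card_insert_of_notMem haB, hBl], B, hBF, hBl,
      Finset.subset_insert _ _⟩
  have hhigh : ∀ D ∈ H, D ∈ F ∧ l + 1 ≤ D.card := by
    intro D hD
    obtain ⟨hDF, hDl⟩ := Finset.mem_filter.1 hD
    have := hmin D hDF
    exact ⟨hDF, by omega⟩
  have hnot : ∀ C ∈ upShadowIn Finset.univ L, ∀ D ∈ H, ¬ C ⊆ D := by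
    intro C hC D hD hCD
    obtain ⟨-, B, hBF, hBl, hBC⟩ := hup C hC
    obtain ⟨hDF, hDl⟩ := hhigh D hD
    have := hS B hBF D hDF (hBC.trans hCD)
    subst this
    omega
  have hdisj : Disjoint H (upShadowIn Finset.univ L) :=
    Finset.disjoint_left.2 fun C hC hC' => hnot C hC' C hC subset_rfl
  have hLne : L.Nonempty := by
    obtain ⟨A, hA, hAl⟩ := hatt
    exact ⟨A, Finset.mem_filter.2 ⟨hA, hAl⟩⟩
  have hexp := card_add_le_card_upShadowIn (U := Finset.univ) (T := ∅) (A := L) (k := l) l hLne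
    (by simp) (by simp) (by simp) (fun B hB => (Finset.mem_filter.1 hB).2) (by simpa using hl)
  rw [Finset.card_univ, Fintype.card_fin] at hexp
  have hsplit : L.card + H.card = F.card := Finset.card_filter_add_card_filter_not _
  have hLcard : 0 < L.card := hLne.card_pos
  have hupne : (upShadowIn Finset.univ L).Nonempty := by
    rw [← Finset.card_pos]
    omega
  refine ⟨H ∪ upShadowIn Finset.univ L, ?_, ?_, ?_, ?_, ?_, ?_⟩
  · intro A hA B hB hAB
    rcases Finset.mem_union.1 hA with hA | hA <;> rcases Finset.mem_union.1 hB with hB | hB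
    · exact hS A (hhigh A hA).1 B (hhigh B hB).1 hAB
    · exact Finset.eq_of_subset_of_card_le hAB ((hup B hB).1.trans_le (hhigh A hA).2)
    · exact absurd hAB (hnot A hA B hB)
    · exact Finset.eq_of_subset_of_card_le hAB ((hup B hB).1.trans_le (hup A hA).1.ge)
  · intro A hA
    rcases Finset.mem_union.1 hA with hA | hA
    · exact (hhigh A hA).2
    · exact (hup A hA).1.ge
  · obtain ⟨C, hC⟩ := hupne
    exact ⟨C, Finset.mem_union_right _ hC, (hup C hC).1⟩
  · rw [Finset.card_union_of_disjoint hdisj]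
    omega
  · intro A hA
    rcases Finset.mem_union.1 hA with hA | hA
    · exact Or.inr (hhigh A hA).1
    · exact Or.inl (hup A hA).1.le
  · intro A hA hAl
    exact Finset.mem_union_left _ (Finset.mem_filter.2 ⟨hA, hAl.ne'⟩)

/-- Push all members of a Sperner family up to level at least `m`. -/
theorem IsSperner.exists_push_up {m : ℕ} (a : ℕ) :
    ∀ {l : ℕ} {F : Finset (Finset (Fin (2 * m + 1)))}, IsSperner F → (∀ A ∈ F, l ≤ A.card) →
      (∃ A ∈ F, A.card = l) → l + a = m →
      ∃ G : Finset (Finset (Fin (2 * m + 1))), IsSperner G ∧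
        F.card + ∑ i ∈ Finset.range a, (m + 1 + i) ≤ G.card ∧
        (∀ A ∈ G, A.card ≤ m ∨ A ∈ F) ∧ (∀ A ∈ F, m < A.card → A ∈ G) := by
  induction a with
  | zero =>
    intro l F hS _ _ _
    exact ⟨F, hS, by simp, fun A hA => Or.inr hA, fun A hA _ => hA⟩
  | succ a ih =>
    intro l F hS hmin hatt hlm
    obtain ⟨G, hG, hGmin, hGatt, hcard, hGF, hFG⟩ :=
      hS.exists_replace_min_level hmin hatt (by omega)
    obtain ⟨K, hK, hKcard, hKG, hGK⟩ := ih hG hGmin hGatt (by omega)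
    refine ⟨K, hK, ?_, fun A hA => ?_, fun A hA hAm => hGK A (hFG A hA (by omega)) hAm⟩
    · rw [Finset.sum_range_succ]
      omega
    · rcases hKG A hA with h | h
      · exact Or.inl h
      · exact (hGF A h).imp_left fun h => by omega

theorem IsSperner.image_compl {n : ℕ} {F : Finset (Finset (Fin n))} (hS : IsSperner F) :
    IsSperner (F.image compl) := by
  intro A hA B hB hAB
  obtain ⟨A', hA', rfl⟩ := Finset.mem_image.1 hA
  obtain ⟨B', hB', rfl⟩ := Finset.mem_image.1 hB
  rw [hS B' hB' A' hA' (Finset.compl_subset_compl.1 hAB)]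

theorem IsSperner.card_le_choose {n : ℕ} {F : Finset (Finset (Fin n))} (hS : IsSperner F) :
    F.card ≤ n.choose (n / 2) := by
  have hF : IsAntichain (· ⊆ ·) (F : Set (Finset (Fin n))) :=
    fun A hA B hB hne hAB => hne (hS A hA B hB hAB)
  simpa using hF.sperner

theorem two_mul_sum_range_add (c a : ℕ) :
    2 * ∑ i ∈ Finset.range a, (c + i) + a = 2 * (a * c) + a * a := by
  induction a with
  | zero => simp
  | succ a ih =>
    rw [Finset.sum_range_succ]
    linarith

/-- For odd `n`, a nonempty Sperner family with minimum member size `l < (n-1)/2` and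
maximum member size `u > (n+1)/2` has
`|F| ≤ C(n, (n-1)/2) - (u-l-1)·(n+1)/2 - ⌊(u-l-2)²/4⌋`. -/
theorem sperner_bound_odd_spread {n l u : ℕ} (hn : Odd n)
    (F : Finset (Finset (Fin n))) (hne : F.Nonempty) (hS : IsSperner F)
    (hlmin : ∀ A ∈ F, l ≤ A.card) (hlatt : ∃ A ∈ F, A.card = l)
    (humax : ∀ A ∈ F, A.card ≤ u) (huatt : ∃ A ∈ F, A.card = u)
    (hl : l < (n - 1) / 2) (hu : (n + 1) / 2 < u) :
    F.card + (u - l - 1) * ((n + 1) / 2) + (u - l - 2) ^ 2 / 4 ≤ n.choose ((n - 1) / 2) := by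
  obtain ⟨m, rfl⟩ := hn
  obtain ⟨a, ha⟩ : ∃ a, l + a = m := ⟨m - l, by omega⟩
  have hun : u ≤ 2 * m + 1 := by
    obtain ⟨A, -, rfl⟩ := huatt
    simpa using A.card_le_univ
  obtain ⟨b, hb⟩ : ∃ b, (2 * m + 1 - u) + b = m := ⟨m - (2 * m + 1 - u), by omega⟩
  obtain ⟨G, hG, hGcard, hGF, hFG⟩ := hS.exists_push_up a hlmin hlatt ha
  have hcompl (A : Finset (Fin (2 * m + 1))) : Aᶜ.card = 2 * m + 1 - A.card := by
    rw [Finset.card_compl, Fintype.card_fin]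
  obtain ⟨K, hK, hKcard, -, -⟩ := hG.image_compl.exists_push_up (l := 2 * m + 1 - u) b
    (by
      intro A hA
      obtain ⟨B, hB, rfl⟩ := Finset.mem_image.1 hA
      rw [hcompl]
      have hBu : B.card ≤ u := by
        rcases hGF B hB with h | h
        · omega
        · exact humax B h
      omega)
    (by
      obtain ⟨B, hB, hBu⟩ := huatt
      exact ⟨Bᶜ, Finset.mem_image_of_mem _ (hFG B hB (by omega)), by rw [hcompl, hBu]⟩) hb
  rw [Finset.card_image_of_injective _ compl_injective] at hKcard
  have hKle := hK.card_le_choose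
  have hsa := two_mul_sum_range_add (m + 1) a
  have hsb := two_mul_sum_range_add (m + 1) b
  obtain ⟨s, hs⟩ : ∃ s, s + 1 = a + b := ⟨a + b - 1, by omega⟩
  have e₁ : u - l - 1 = s + 1 := by omega
  have e₂ : u - l - 2 = s := by omega
  have e₃ : (2 * m + 1 + 1) / 2 = m + 1 := by omega
  have e₄ : (2 * m + 1 - 1) / 2 = (2 * m + 1) / 2 := by omega
  rw [e₁, e₂, e₃, e₄]
  have hq : 4 * (s ^ 2 / 4) ≤ s ^ 2 := Nat.mul_div_le _ _
  have hprod : (s + 1) * (m + 1) = a * (m + 1) + b * (m + 1) := by rw [hs]; ring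
  have hsq : (s + 1) ^ 2 ≤ 2 * (a * a + b * b) := by
    rw [hs]
    zify
    nlinarith [sq_nonneg ((a : ℤ) - b)]
  have hexpand : (s + 1) ^ 2 = s ^ 2 + 2 * s + 1 := by ring
  omega
end
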